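/- arXiv:1407.1305 — 2 statements merged into one kernel-verified Lean document; each statement's English description precedes it below -/
import Mathlib

section
/- Each of the following seven polynomials is a 2-graded identity of the algebra E_{0*}⊗E_0: (1) [y_1,y_2,x_3] where x_3 = y_3 or x_3 = z_3; (2) [y_1,z_2,y_3]; (3) [y_1,z_2]∘z_3; (4) [z_1∘z_2, z_3]; (5) (z_1∘z_2)(z_3∘z_4) − (z_1∘z_3)(z_2∘z_4); (6) [x_1,y_2][y_3,x_4] + [x_1,y_3][y_2,x_4] for all choices of x_1, x_4 among even or odd variables; (7) [y_1,z_2](z_3∘z_4) − [y_1,z_3](z_2∘z_4). Consequently the T_2-ideal I generated by these polynomials is contained in T_2(E_{0*}⊗E_0). -/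
open scoped TensorProduct

noncomputable section

namespace Paper

variable (K : Type) [Field K]

/-- The Grassmann algebra `E` of a vector space with countable basis. -/
abbrev E := ExteriorAlgebra K (ℕ →₀ K)

/-- The generators `e_i` of the Grassmann algebra (0-based indexing). -/
def eGen (i : ℕ) : E K := ExteriorAlgebra.ι K (Finsupp.single i 1)

/-- The basis monomial `e_{i_1} ⋯ e_{i_k}` of `E`, `i_1 < ⋯ < i_k`, indexed by a finite set. -/
def eMon (s : Finset ℕ) : E K := ((s.sort (· ≤ ·)).map (eGen K)).prod

/-- The algebra `A = E ⊗ E`. -/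
abbrev A := E K ⊗[K] E K

/-- The canonical basis of `E ⊗ E`, indexed by pairs of finite sets (= supports). -/
def bEE (q : Finset ℕ × Finset ℕ) : A K := eMon K q.1 ⊗ₜ[K] eMon K q.2

/-- The `ℤ₂ × ℤ₂`-degree of a canonical basis element in the canonical grading of `E ⊗ E`. -/
def gdeg (q : Finset ℕ × Finset ℕ) : ZMod 2 × ZMod 2 :=
  ((q.1.card : ZMod 2), (q.2.card : ZMod 2))

/-- The homogeneous component of degree `g` of the canonical `ℤ₂ × ℤ₂`-grading of `E ⊗ E`. -/
def Acomp (g : ZMod 2 × ZMod 2) : Submodule K (A K) :=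
  Submodule.span K { a | ∃ q, gdeg q = g ∧ a = bEE K q }

/-- Degree of a basis monomial of `E ⊗ E` in the `ℤ₂`-grading induced by weight functions
`w₁, w₂` on the generators of the two factors. -/
def wdeg (w₁ w₂ : ℕ → ZMod 2) (q : Finset ℕ × Finset ℕ) : ZMod 2 :=
  (∑ i ∈ q.1, w₁ i) + (∑ j ∈ q.2, w₂ j)

/-- Homogeneous component of degree `δ` of the `ℤ₂`-grading of `E ⊗ E` induced by weights. -/
def Agr (w₁ w₂ : ℕ → ZMod 2) (δ : ZMod 2) : Submodule K (A K) :=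
  Submodule.span K { a | ∃ q, wdeg w₁ w₂ q = δ ∧ a = bEE K q }

/-- Weights for `E_∞`:  `‖e_i‖ = 1` iff `i` is even (paper's 1-based `e_i` is our `i-1`). -/
def wInf : ℕ → ZMod 2 := fun i => if i % 2 = 1 then 1 else 0

/-- Weights for `E_{k*}`:  `‖e_i‖ = 1` for `i ≤ k`, else `0`. -/
def wKstar (k : ℕ) : ℕ → ZMod 2 := fun i => if i < k then 1 else 0

/-- Weights for `E_k`:  `‖e_i‖ = 0` for `i ≤ k`, else `1`. -/
def wK (k : ℕ) : ℕ → ZMod 2 := fun i => if i < k then 0 else 1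

/-- The `ℤ₂`-grading `E_{0*} ⊗ E_0` of `A = E ⊗ E`: `A₀ = E⊗E⁰`, `A₁ = E⊗E¹`. -/
def A0star (δ : ZMod 2) : Submodule K (A K) := Agr K (wKstar 0) (wK 0) δ

/-- The free associative algebra `K⟨Y ∪ Z⟩`: variable `(false, i)` is `y_i`,
variable `(true, i)` is `z_i`. -/
abbrev FA := FreeAlgebra K (Bool × ℕ)

/-- The even variables `y_i`. -/
def Yv (i : ℕ) : FA K := FreeAlgebra.ι K (false, i)

/-- The odd variables `z_i`. -/
def Zv (i : ℕ) : FA K := FreeAlgebra.ι K (true, i)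

/-- The Jordan product `a ∘ b = ab + ba`. -/
def circ {R : Type*} [Ring R] (a b : R) : R := a * b + b * a

/-- Substitution `y_i ↦ a i`, `z_i ↦ z i` as an algebra homomorphism. -/
def ev {B : Type*} [Ring B] [Algebra K B] (a z : ℕ → B) : FA K →ₐ[K] B :=
  FreeAlgebra.lift K (fun v => if v.1 then z v.2 else a v.2)

/-- `f` is a 2-graded polynomial identity of the `ℤ₂`-graded algebra `B = B₀ ⊕ B₁`. -/
def GIdent {B : Type*} [Ring B] [Algebra K B] (B0 B1 : Submodule K B) (f : FA K) : Prop :=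
  ∀ a z : ℕ → B, (∀ i, a i ∈ B0) → (∀ i, z i ∈ B1) → ev K a z f = 0

/-- `f` is an ordinary polynomial identity of `B`. -/
def OIdent (B : Type) [Ring B] [Algebra K B] (f : FA K) : Prop :=
  ∀ u : Bool × ℕ → B, FreeAlgebra.lift K u f = 0

/-- The homogeneous component of degree `δ` of the free algebra `K⟨Y ∪ Z⟩`
(span of the monomials whose number of odd variables has parity `δ`). -/
def FAdeg (δ : ZMod 2) : Submodule K (FA K) :=
  Submodule.span K { w | ∃ l : List (Bool × ℕ),
    ((l.countP (fun v => v.1) : ℕ) : ZMod 2) = δ ∧ w = (l.map (FreeAlgebra.ι K)).prod }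

/-- A grading-preserving endomorphism of the free algebra `K⟨Y ∪ Z⟩`. -/
def GradedEndo (φ : FA K →ₐ[K] FA K) : Prop :=
  (∀ i, φ (Yv K i) ∈ FAdeg K 0) ∧ (∀ i, φ (Zv K i) ∈ FAdeg K 1)

/-- A two-sided ideal of `K⟨Y ∪ Z⟩` is a `T₂`-ideal if it is invariant under all
grading-preserving endomorphisms. -/
def IsT2Ideal (J : TwoSidedIdeal (FA K)) : Prop :=
  ∀ φ : FA K →ₐ[K] FA K, GradedEndo K φ → ∀ x ∈ J, φ x ∈ J

/-- The `T₂`-ideal generated by a set `S`: the smallest two-sided ideal containing `S`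
and invariant under all grading-preserving endomorphisms. -/
def T2IdealGen (S : Set (FA K)) : TwoSidedIdeal (FA K) :=
  sInf { J | S ⊆ J ∧ IsT2Ideal K J }

/-- The generators (1)–(7) of the `T₂`-ideal `I`. -/
def gens : Set (FA K) :=
  { ⁅⁅Yv K 1, Yv K 2⁆, Yv K 3⁆, ⁅⁅Yv K 1, Yv K 2⁆, Zv K 3⁆,
    ⁅⁅Yv K 1, Zv K 2⁆, Yv K 3⁆,
    circ ⁅Yv K 1, Zv K 2⁆ (Zv K 3),
    ⁅circ (Zv K 1) (Zv K 2), Zv K 3⁆,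
    circ (Zv K 1) (Zv K 2) * circ (Zv K 3) (Zv K 4)
      - circ (Zv K 1) (Zv K 3) * circ (Zv K 2) (Zv K 4),
    ⁅Yv K 1, Yv K 2⁆ * ⁅Yv K 3, Yv K 4⁆ + ⁅Yv K 1, Yv K 3⁆ * ⁅Yv K 2, Yv K 4⁆,
    ⁅Yv K 1, Yv K 2⁆ * ⁅Yv K 3, Zv K 4⁆ + ⁅Yv K 1, Yv K 3⁆ * ⁅Yv K 2, Zv K 4⁆,
    ⁅Zv K 1, Yv K 2⁆ * ⁅Yv K 3, Yv K 4⁆ + ⁅Zv K 1, Yv K 3⁆ * ⁅Yv K 2, Yv K 4⁆,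
    ⁅Zv K 1, Yv K 2⁆ * ⁅Yv K 3, Zv K 4⁆ + ⁅Zv K 1, Yv K 3⁆ * ⁅Yv K 2, Zv K 4⁆,
    ⁅Yv K 1, Zv K 2⁆ * circ (Zv K 3) (Zv K 4) - ⁅Yv K 1, Zv K 3⁆ * circ (Zv K 2) (Zv K 4) }

/-- The product `[y_1, z_1][y_2, z_1] ⋯ [y_k, z_1]`. -/
def prodYZ (k : ℕ) : FA K := ((List.range k).map (fun i => ⁅Yv K (i + 1), Zv K 1⁆)).prod

/-- The generators (1)–(7) together with (8) and (9) of the `T₂`-ideal `I_p`. -/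
def gensP (p : ℕ) : Set (FA K) :=
  gens K ∪ { f | ∃ n k : ℕ, 1 ≤ k ∧ 2 * n + 2 * k - 1 = p ∧
    (f = prodYZ K (2 * k - 2) * circ (Zv K 2) (Zv K 1) * (Zv K 1) ^ (2 * n) ∨
     f = prodYZ K (2 * k - 1) * (Zv K 1) ^ (2 * n)) }

/-- The polynomial `h = h_y · h_{y,z} · h_z`, given by the lists of index pairs of the
commutators `[y,y]`, the commutators `[y,z]` and the Jordan products `z ∘ z`. -/
def hpoly (ly lyz lz : List (ℕ × ℕ)) : FA K :=
  (ly.map (fun p => ⁅Yv K p.1, Yv K p.2⁆)).prod *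
  (lyz.map (fun p => ⁅Yv K p.1, Zv K p.2⁆)).prod *
  (lz.map (fun p => circ (Zv K p.1) (Zv K p.2))).prod

/-- The list `i_1, …, i_{2m+n}` of indices of the even variables occurring in `h`. -/
def yIdx (ly lyz : List (ℕ × ℕ)) : List ℕ :=
  (ly.flatMap fun p => [p.1, p.2]) ++ lyz.map Prod.fst

/-- The list `j_1, …, j_{n+2p}` of indices of the odd variables occurring in `h`. -/
def zIdx (lyz lz : List (ℕ × ℕ)) : List ℕ :=
  lyz.map Prod.snd ++ (lz.flatMap fun p => [p.1, p.2])

/-- A left-normed higher commutator of variables `[x_{v}, x_{w}, x_{u_1}, …]` (length ≥ 2). -/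
def commList (v w : Bool × ℕ) (l : List (Bool × ℕ)) : FA K :=
  l.foldl (fun acc u => ⁅acc, FreeAlgebra.ι K u⁆) ⁅FreeAlgebra.ι K v, FreeAlgebra.ι K w⁆

/-- The generators of the subalgebra `B(Y,Z)` of `Y`-proper polynomials: the odd variables
and the nontrivial higher commutators of variables. -/
def ProperGens : Set (FA K) :=
  Set.range (Zv K) ∪ { c | ∃ v w l, c = commList K v w l }

end Paper

namespace Paper

section Grassmann

variable {K : Type} [Field K]

/-- The component of parity `i` in the canonical `ℤ₂`-grading of the Grassmann algebra. -/
abbrev parity (K : Type) [Field K] (i : ZMod 2) : Submodule K (E K) :=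
  CliffordAlgebra.evenOdd (0 : QuadraticForm K (ℕ →₀ K)) i

theorem mul_mem_parity {i j : ZMod 2} {a b : E K} (ha : a ∈ parity K i) (hb : b ∈ parity K j) :
    a * b ∈ parity K (i + j) :=
  CliffordAlgebra.evenOdd_mul_le _ i j (Submodule.mul_mem_mul ha hb)

theorem parity_mul_comm {i j : ZMod 2} {a b : E K} (ha : a ∈ parity K i) (hb : b ∈ parity K j) :
    a * b = (-1 : ℤˣ) ^ (j * i) • (b * a) := by
  have h := CliffordAlgebra.map_mul_map_of_isOrtho_of_mem_evenOdd
    (QuadraticMap.Isometry.id (0 : QuadraticForm K (ℕ →₀ K)))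
    (QuadraticMap.Isometry.id (0 : QuadraticForm K (ℕ →₀ K)))
    (fun x y => by simp [QuadraticMap.isOrtho_def]) a b ha hb
  simpa [CliffordAlgebra.map_id] using h

theorem mem_even_sup_odd (x : E K) : x ∈ parity K 0 ⊔ parity K 1 := by
  rw [(CliffordAlgebra.evenOdd_isCompl _).sup_eq_top]
  trivial

theorem even_commute {a b : E K} (ha : a ∈ parity K 0) : a * b = b * a := by
  obtain ⟨c, hc, d, hd, rfl⟩ := Submodule.mem_sup.1 (mem_even_sup_odd b)
  rw [mul_add, add_mul, parity_mul_comm ha hc, parity_mul_comm ha hd]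
  simp

theorem odd_anticommute {a b : E K} (ha : a ∈ parity K 1) (hb : b ∈ parity K 1) :
    a * b = -(b * a) := by
  rw [parity_mul_comm ha hb]
  simp

theorem odd_mul_odd_mem {a b : E K} (ha : a ∈ parity K 1) (hb : b ∈ parity K 1) :
    a * b ∈ parity K 0 := by
  simpa [CharTwo.add_self_eq_zero] using mul_mem_parity ha hb

theorem lie_add_add_eq {R : Type*} [Ring R] {a₀ a₁ b₀ b₁ : R}
    (h₀ : a₀ * (b₀ + b₁) = (b₀ + b₁) * a₀) (h₁ : b₀ * a₁ = a₁ * b₀) :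
    ⁅a₀ + a₁, b₀ + b₁⁆ = a₁ * b₁ - b₁ * a₁ := by
  rw [Ring.lie_def, add_mul, h₀, mul_add a₁, ← h₁]
  noncomm_ring

theorem lie_mem_even (a b : E K) : ⁅a, b⁆ ∈ parity K 0 := by
  obtain ⟨a₀, ha₀, a₁, ha₁, rfl⟩ := Submodule.mem_sup.1 (mem_even_sup_odd a)
  obtain ⟨b₀, hb₀, b₁, hb₁, rfl⟩ := Submodule.mem_sup.1 (mem_even_sup_odd b)
  rw [lie_add_add_eq (even_commute ha₀) (even_commute hb₀)]
  exact sub_mem (odd_mul_odd_mem ha₁ hb₁) (odd_mul_odd_mem hb₁ ha₁)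

theorem lie_lie_eq_zero (a b c : E K) : ⁅⁅a, b⁆, c⁆ = 0 := by
  rw [Ring.lie_def, even_commute (lie_mem_even a b), sub_self]

theorem lie_mul_lie_swap (a b c d : E K) : ⁅a, b⁆ * ⁅c, d⁆ = -(⁅a, c⁆ * ⁅b, d⁆) := by
  have h₀ := lie_lie_eq_zero a (b * c) d
  have h : ⁅⁅a, b * c⁆, d⁆ = ⁅a, b⁆ * ⁅c, d⁆ + ⁅⁅a, b⁆, d⁆ * c
      + (⁅b, d⁆ * ⁅a, c⁆ + b * ⁅⁅a, c⁆, d⁆) := by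
    simp only [Ring.lie_def]; noncomm_ring
  rw [h, lie_lie_eq_zero, lie_lie_eq_zero, even_commute (lie_mem_even b d)] at h₀
  simpa using eq_neg_of_add_eq_zero_left (by simpa using h₀)

theorem eGen_mem_odd (i : ℕ) : eGen K i ∈ parity K 1 :=
  CliffordAlgebra.ι_mem_evenOdd_one _ _

theorem prod_eGen_mem_parity (l : List ℕ) : (l.map (eGen K)).prod ∈ parity K l.length := by
  induction l with
  | nil => simpa using Submodule.one_le.1 (CliffordAlgebra.one_le_evenOdd_zero _)
  | cons i l ih =>
    simpa [add_comm] using mul_mem_parity (eGen_mem_odd i) ih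

theorem eMon_mem_parity (s : Finset ℕ) : eMon K s ∈ parity K s.card := by
  simpa [eMon] using prod_eGen_mem_parity (K := K) (s.sort (· ≤ ·))

/-- Reordering a product of generators changes it at most by a sign. -/
theorem prod_eGen_perm {l l' : List ℕ} (h : l.Perm l') :
    (l.map (eGen K)).prod = (l'.map (eGen K)).prod ∨
      (l.map (eGen K)).prod = -(l'.map (eGen K)).prod := by
  induction h with
  | nil => simp
  | cons x _ ih => rcases ih with h | h <;> simp [h]
  | swap x y l =>
    right
    simp only [List.map_cons, List.prod_cons, ← mul_assoc]
    rw [odd_anticommute (eGen_mem_odd y) (eGen_mem_odd x), neg_mul]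
  | trans _ _ h₁ h₂ => rcases h₁ with h₁ | h₁ <;> rcases h₂ with h₂ | h₂ <;> simp [h₁, h₂]

/-- The span of the basis monomials of parity `δ`. -/
def monSpan (K : Type) [Field K] (δ : ZMod 2) : Submodule K (E K) :=
  Submodule.span K {a | ∃ s : Finset ℕ, (s.card : ZMod 2) = δ ∧ a = eMon K s}

theorem prod_eGen_mem_monSpan (l : List ℕ) : (l.map (eGen K)).prod ∈ monSpan K l.length := by
  by_cases hl : l.Nodup
  · have hp : l.Perm (l.toFinset.sort (· ≤ ·)) :=
      (List.perm_of_nodup_nodup_toFinset_eq hl (Finset.sort_nodup _ _) (by simp))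
    have hm : eMon K l.toFinset ∈ monSpan K l.length :=
      Submodule.subset_span ⟨_, by rw [List.toFinset_card_of_nodup hl], rfl⟩
    rcases prod_eGen_perm (K := K) hp with h | h <;> rw [h]
    · exact hm
    · exact neg_mem hm
  · obtain ⟨x, hx⟩ := List.exists_duplicate_iff_not_nodup.2 hl
    obtain ⟨t, ht⟩ := (List.duplicate_iff_sublist.1 hx).exists_perm_append
    have h₀ : (([x, x] ++ t).map (eGen K)).prod = 0 := by
      simp [← mul_assoc, eGen]
    have h : (l.map (eGen K)).prod = 0 := by
      rcases prod_eGen_perm (K := K) ht with h | h <;> rw [h, h₀]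
      exact neg_zero
    rw [h]
    exact zero_mem _

theorem eMon_mul_eMon_mem (s t : Finset ℕ) :
    eMon K s * eMon K t ∈ monSpan K (s.card + t.card) := by
  have h := prod_eGen_mem_monSpan (K := K) (s.sort (· ≤ ·) ++ t.sort (· ≤ ·))
  simpa [eMon] using h

end Grassmann

section Grading

variable {K : Type} [Field K]

theorem wdeg_zeroStar_zero (q : Finset ℕ × Finset ℕ) :
    wdeg (wKstar 0) (wK 0) q = q.2.card := by
  simp [wdeg, wKstar, wK]

theorem tmul_mem_A0star {ε δ : ZMod 2} {a b : E K} (ha : a ∈ monSpan K ε) (hb : b ∈ monSpan K δ) :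
    a ⊗ₜ[K] b ∈ A0star K δ := by
  induction ha using Submodule.span_induction with
  | zero => simp
  | add x y _ _ hx hy => rw [TensorProduct.add_tmul]; exact add_mem hx hy
  | smul c x _ hx => rw [← TensorProduct.smul_tmul']; exact Submodule.smul_mem _ _ hx
  | mem x hx =>
    obtain ⟨s, -, rfl⟩ := hx
    induction hb using Submodule.span_induction with
    | zero => simp
    | add x y _ _ hx hy => rw [TensorProduct.tmul_add]; exact add_mem hx hy
    | smul c x _ hx => rw [TensorProduct.tmul_smul]; exact Submodule.smul_mem _ _ hx
    | mem y hy =>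
      obtain ⟨t, ht, rfl⟩ := hy
      exact Submodule.subset_span ⟨(s, t), by rw [wdeg_zeroStar_zero]; exact ht, rfl⟩

theorem mul_mem_A0star {i j : ZMod 2} {x y : A K} (hx : x ∈ A0star K i) (hy : y ∈ A0star K j) :
    x * y ∈ A0star K (i + j) := by
  have h : A0star K i * A0star K j ≤ A0star K (i + j) := by
    rw [A0star, Agr, A0star, Agr, Submodule.span_mul_span, Submodule.span_le]
    rintro _ ⟨_, ⟨p, hp, rfl⟩, _, ⟨q, hq, rfl⟩, rfl⟩
    rw [wdeg_zeroStar_zero] at hp hq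
    simp only [bEE, Algebra.TensorProduct.tmul_mul_tmul, ← hp, ← hq]
    exact tmul_mem_A0star (eMon_mul_eMon_mem _ _) (eMon_mul_eMon_mem _ _)
  exact h (Submodule.mul_mem_mul hx hy)

theorem one_mem_A0star : (1 : A K) ∈ A0star K 0 :=
  Submodule.subset_span ⟨(∅, ∅), by simp [wdeg], by
    simp [bEE, eMon, Algebra.TensorProduct.one_def]⟩

/-- The pure tensors `a ⊗ g` with `g` of parity `δ`. -/
def pureTensors (K : Type) [Field K] (δ : ZMod 2) : Set (A K) :=
  {x | ∃ a, ∃ g ∈ parity K δ, x = a ⊗ₜ[K] g}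

theorem A0star_le_span (δ : ZMod 2) : A0star K δ ≤ Submodule.span K (pureTensors K δ) := by
  refine Submodule.span_mono ?_
  rintro _ ⟨q, hq, rfl⟩
  rw [wdeg_zeroStar_zero] at hq
  exact ⟨_, _, hq ▸ eMon_mem_parity q.2, rfl⟩

theorem ev_mem_A0star {a z : ℕ → A K} (ha : ∀ i, a i ∈ A0star K 0) (hz : ∀ i, z i ∈ A0star K 1)
    {δ : ZMod 2} {f : FA K} (hf : f ∈ FAdeg K δ) : ev K a z f ∈ A0star K δ := by
  induction hf using Submodule.span_induction with
  | zero => simp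
  | add x y _ _ hx hy => rw [map_add]; exact add_mem hx hy
  | smul c x _ hx => rw [map_smul]; exact Submodule.smul_mem _ _ hx
  | mem w hw =>
    obtain ⟨l, rfl, rfl⟩ := hw
    induction l with
    | nil => simpa using one_mem_A0star
    | cons v l ih =>
      obtain ⟨b, i⟩ := v
      have hv : ev K a z (FreeAlgebra.ι K (b, i)) ∈ A0star K (if b then 1 else 0) := by
        cases b <;> simp [ev, ha, hz]
      have := mul_mem_A0star hv ih
      cases b <;> simpa [add_comm] using this

end Grading

section T2Ideal

variable {K : Type} [Field K]

/-- The two-sided ideal of 2-graded identities of `E_{0*} ⊗ E_0`. -/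
def identityIdeal (K : Type) [Field K] : TwoSidedIdeal (FA K) :=
  sInf {J | ∃ a z : ℕ → A K, (∀ i, a i ∈ A0star K 0) ∧ (∀ i, z i ∈ A0star K 1) ∧
    J = TwoSidedIdeal.ker (ev K a z)}

theorem mem_identityIdeal {f : FA K} :
    f ∈ identityIdeal K ↔ GIdent K (A0star K 0) (A0star K 1) f := by
  rw [identityIdeal, TwoSidedIdeal.mem_sInf]
  constructor
  · intro h a z ha hz
    exact (TwoSidedIdeal.mem_ker _).1 (h _ ⟨a, z, ha, hz, rfl⟩)
  · rintro h _ ⟨a, z, ha, hz, rfl⟩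
    exact (TwoSidedIdeal.mem_ker _).2 (h a z ha hz)

theorem isT2Ideal_identityIdeal : IsT2Ideal K (identityIdeal K) := by
  intro φ hφ f hf
  rw [mem_identityIdeal] at hf ⊢
  intro a z ha hz
  have h : (ev K a z).comp φ =
      ev K (fun i => ev K a z (φ (Yv K i))) (fun i => ev K a z (φ (Zv K i))) := by
    apply FreeAlgebra.hom_ext
    funext v
    obtain ⟨_ | _, i⟩ := v <;> simp [ev, Yv, Zv]
  have h' := DFunLike.congr_fun h f
  rw [AlgHom.comp_apply] at h'
  rw [h']
  exact hf _ _ (fun i => ev_mem_A0star ha hz (hφ.1 i)) (fun i => ev_mem_A0star ha hz (hφ.2 i))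

end T2Ideal

section Identities

variable {K : Type} [Field K]

theorem lie_tmul {a b g h : E K} (hgh : g * h = h * g) :
    ⁅a ⊗ₜ[K] g, b ⊗ₜ[K] h⁆ = ⁅a, b⁆ ⊗ₜ[K] (g * h) := by
  simp only [Ring.lie_def, Algebra.TensorProduct.tmul_mul_tmul, ← hgh, TensorProduct.sub_tmul]

theorem circ_tmul {a b g h : E K} (hgh : g * h = -(h * g)) :
    circ (a ⊗ₜ[K] g) (b ⊗ₜ[K] h) = ⁅a, b⁆ ⊗ₜ[K] (g * h) := by
  simp only [circ, Ring.lie_def, Algebra.TensorProduct.tmul_mul_tmul, TensorProduct.sub_tmul, hgh,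
    TensorProduct.tmul_neg]
  abel

theorem eq_zero_of_mem_span₃ {M N : Type*} [AddCommGroup M] [Module K M] [AddCommGroup N]
    [Module K N] {S₁ S₂ S₃ : Set M} (F : M → M → M → N)
    (h₁ : ∀ y z, IsLinearMap K fun x => F x y z) (h₂ : ∀ x z, IsLinearMap K fun y => F x y z)
    (h₃ : ∀ x y, IsLinearMap K fun z => F x y z)
    (h : ∀ x ∈ S₁, ∀ y ∈ S₂, ∀ z ∈ S₃, F x y z = 0) {x y z : M}
    (hx : x ∈ Submodule.span K S₁) (hy : y ∈ Submodule.span K S₂)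
    (hz : z ∈ Submodule.span K S₃) : F x y z = 0 := by
  have key {S : Set M} {f : M → N} (hf : IsLinearMap K f) (h : ∀ x ∈ S, f x = 0) {x : M}
      (hx : x ∈ Submodule.span K S) : f x = 0 :=
    (Submodule.span_le (p := LinearMap.ker hf.mk')).2 h hx
  exact key (h₁ y z) (fun x hx => key (h₂ x z) (fun y hy => key (h₃ x y) (h x hx y hy) hz) hy) hx

theorem eq_zero_of_mem_span₄ {M N : Type*} [AddCommGroup M] [Module K M] [AddCommGroup N]
    [Module K N] {S₁ S₂ S₃ S₄ : Set M} (F : M → M → M → M → N)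
    (h₁ : ∀ y z w, IsLinearMap K fun x => F x y z w)
    (h₂ : ∀ x z w, IsLinearMap K fun y => F x y z w)
    (h₃ : ∀ x y w, IsLinearMap K fun z => F x y z w)
    (h₄ : ∀ x y z, IsLinearMap K fun w => F x y z w)
    (h : ∀ x ∈ S₁, ∀ y ∈ S₂, ∀ z ∈ S₃, ∀ w ∈ S₄, F x y z w = 0) {x y z w : M}
    (hx : x ∈ Submodule.span K S₁) (hy : y ∈ Submodule.span K S₂)
    (hz : z ∈ Submodule.span K S₃) (hw : w ∈ Submodule.span K S₄) : F x y z w = 0 := by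
  refine (Submodule.span_le (p := LinearMap.ker ((h₄ x y z).mk'))).2 (fun w hw => ?_) hw
  exact eq_zero_of_mem_span₃ (fun x y z => F x y z w) (fun _ _ => h₁ _ _ _) (fun _ _ => h₂ _ _ _)
    (fun _ _ => h₃ _ _ _) (fun x hx y hy z hz => h x hx y hy z hz w hw) hx hy hz

theorem lie_lie_span {j k : ZMod 2} (hjk : j = 0 ∨ k = 0) {x y z : A K}
    (hx : x ∈ Submodule.span K (pureTensors K 0)) (hy : y ∈ Submodule.span K (pureTensors K j))
    (hz : z ∈ Submodule.span K (pureTensors K k)) : ⁅⁅x, y⁆, z⁆ = 0 := by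
  refine eq_zero_of_mem_span₃ (fun x y z => ⁅⁅x, y⁆, z⁆) ?_ ?_ ?_ ?_ hx hy hz
  iterate 3
    intros
    constructor <;> intros
    · simp only [Ring.lie_def]
      noncomm_ring
    · simp only [Ring.lie_def, smul_mul_assoc, mul_smul_comm, ← smul_sub]
  rintro _ ⟨a, g, hg, rfl⟩ _ ⟨b, h, hh, rfl⟩ _ ⟨c, k, hk, rfl⟩
  have hc : g * h * k = k * (g * h) := by
    rcases hjk with rfl | rfl
    · exact even_commute (by simpa using mul_mem_parity hg hh)
    · exact (even_commute hk).symm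
  simp only [lie_tmul (even_commute hg), lie_tmul hc, lie_lie_eq_zero, TensorProduct.zero_tmul]

theorem circ_lie_span {x y z : A K}
    (hx : x ∈ Submodule.span K (pureTensors K 0)) (hy : y ∈ Submodule.span K (pureTensors K 1))
    (hz : z ∈ Submodule.span K (pureTensors K 1)) : circ ⁅x, y⁆ z = 0 := by
  refine eq_zero_of_mem_span₃ (fun x y z => circ ⁅x, y⁆ z) ?_ ?_ ?_ ?_ hx hy hz
  iterate 3
    intros
    constructor <;> intros
    · simp only [circ, Ring.lie_def]
      noncomm_ring
    · simp only [circ, Ring.lie_def, smul_mul_assoc, mul_smul_comm, ← smul_add, ← smul_sub]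
  rintro _ ⟨a, g, hg, rfl⟩ _ ⟨b, h, hh, rfl⟩ _ ⟨c, k, hk, rfl⟩
  have hc : g * h * k = -(k * (g * h)) :=
    odd_anticommute (by simpa using mul_mem_parity hg hh) hk
  simp only [lie_tmul (even_commute hg), circ_tmul hc, lie_lie_eq_zero, TensorProduct.zero_tmul]

theorem lie_circ_span {k : ZMod 2} {x y z : A K}
    (hx : x ∈ Submodule.span K (pureTensors K 1)) (hy : y ∈ Submodule.span K (pureTensors K 1))
    (hz : z ∈ Submodule.span K (pureTensors K k)) : ⁅circ x y, z⁆ = 0 := by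
  refine eq_zero_of_mem_span₃ (fun x y z => ⁅circ x y, z⁆) ?_ ?_ ?_ ?_ hx hy hz
  iterate 3
    intros
    constructor <;> intros
    · simp only [circ, Ring.lie_def]
      noncomm_ring
    · simp only [circ, Ring.lie_def, smul_mul_assoc, mul_smul_comm, ← smul_add, ← smul_sub]
  rintro _ ⟨a, g, hg, rfl⟩ _ ⟨b, h, hh, rfl⟩ _ ⟨c, k, hk, rfl⟩
  have hc : g * h * k = k * (g * h) :=
    even_commute (odd_mul_odd_mem hg hh)
  simp only [circ_tmul (odd_anticommute hg hh), lie_tmul hc, lie_lie_eq_zero,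
    TensorProduct.zero_tmul]

theorem circ_mul_circ_span {x y z w : A K}
    (hx : x ∈ Submodule.span K (pureTensors K 1)) (hy : y ∈ Submodule.span K (pureTensors K 1))
    (hz : z ∈ Submodule.span K (pureTensors K 1)) (hw : w ∈ Submodule.span K (pureTensors K 1)) :
    circ x y * circ z w - circ x z * circ y w = 0 := by
  refine eq_zero_of_mem_span₄ (fun x y z w => circ x y * circ z w - circ x z * circ y w)
    ?_ ?_ ?_ ?_ ?_ hx hy hz hw
  iterate 4
    intros
    constructor <;> intros
    · simp only [circ]
      noncomm_ring
    · simp only [circ, smul_mul_assoc, mul_smul_comm, ← smul_add, ← smul_sub]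
  rintro _ ⟨a, g, hg, rfl⟩ _ ⟨b, h, hh, rfl⟩ _ ⟨c, k, hk, rfl⟩ _ ⟨d, l, hl, rfl⟩
  have hc : g * k * (h * l) = -(g * h * (k * l)) := by
    rw [mul_assoc, ← mul_assoc k, odd_anticommute hk hh]
    noncomm_ring
  simp only [circ_tmul (odd_anticommute hg hh), circ_tmul (odd_anticommute hk hl),
    circ_tmul (odd_anticommute hg hk), circ_tmul (odd_anticommute hh hl),
    Algebra.TensorProduct.tmul_mul_tmul, lie_mul_lie_swap a b c d, hc]
  simp [TensorProduct.neg_tmul, TensorProduct.tmul_neg]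

theorem lie_mul_circ_span {x y z w : A K}
    (hx : x ∈ Submodule.span K (pureTensors K 0)) (hy : y ∈ Submodule.span K (pureTensors K 1))
    (hz : z ∈ Submodule.span K (pureTensors K 1)) (hw : w ∈ Submodule.span K (pureTensors K 1)) :
    ⁅x, y⁆ * circ z w - ⁅x, z⁆ * circ y w = 0 := by
  refine eq_zero_of_mem_span₄ (fun x y z w => ⁅x, y⁆ * circ z w - ⁅x, z⁆ * circ y w)
    ?_ ?_ ?_ ?_ ?_ hx hy hz hw
  iterate 4
    intros
    constructor <;> intros
    · simp only [circ, Ring.lie_def]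
      noncomm_ring
    · simp only [circ, Ring.lie_def, smul_mul_assoc, mul_smul_comm, ← smul_add, ← smul_sub]
  rintro _ ⟨a, g, hg, rfl⟩ _ ⟨b, h, hh, rfl⟩ _ ⟨c, k, hk, rfl⟩ _ ⟨d, l, hl, rfl⟩
  have hc : g * k * (h * l) = -(g * h * (k * l)) := by
    rw [mul_assoc, ← mul_assoc k, odd_anticommute hk hh]
    noncomm_ring
  simp only [lie_tmul (even_commute hg), circ_tmul (odd_anticommute hk hl),
    circ_tmul (odd_anticommute hh hl),
    Algebra.TensorProduct.tmul_mul_tmul, lie_mul_lie_swap a b c d, hc]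
  simp [TensorProduct.neg_tmul, TensorProduct.tmul_neg]

theorem lie_mul_lie_span {i j : ZMod 2} {x y z w : A K}
    (hx : x ∈ Submodule.span K (pureTensors K i)) (hy : y ∈ Submodule.span K (pureTensors K 0))
    (hz : z ∈ Submodule.span K (pureTensors K 0)) (hw : w ∈ Submodule.span K (pureTensors K j)) :
    ⁅x, y⁆ * ⁅z, w⁆ + ⁅x, z⁆ * ⁅y, w⁆ = 0 := by
  refine eq_zero_of_mem_span₄ (fun x y z w => ⁅x, y⁆ * ⁅z, w⁆ + ⁅x, z⁆ * ⁅y, w⁆)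
    ?_ ?_ ?_ ?_ ?_ hx hy hz hw
  iterate 4
    intros
    constructor <;> intros
    · simp only [Ring.lie_def]
      noncomm_ring
    · simp only [Ring.lie_def, smul_mul_assoc, mul_smul_comm, ← smul_add, ← smul_sub]
  rintro _ ⟨a, g, hg, rfl⟩ _ ⟨b, h, hh, rfl⟩ _ ⟨c, k, hk, rfl⟩ _ ⟨d, l, hl, rfl⟩
  have hc : g * k * (h * l) = g * h * (k * l) := by
    rw [mul_assoc, ← mul_assoc k, even_commute hk]
    noncomm_ring
  simp only [lie_tmul (even_commute hh).symm, lie_tmul (even_commute hk).symm,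
    lie_tmul (even_commute hh), lie_tmul (even_commute hk),
    Algebra.TensorProduct.tmul_mul_tmul, lie_mul_lie_swap a b c d, hc]
  simp [TensorProduct.neg_tmul]

theorem gIdent_of_mem_gens {f : FA K} (hf : f ∈ gens K) :
    GIdent K (A0star K 0) (A0star K 1) f := by
  intro a z ha hz
  have hY (i : ℕ) : ev K a z (Yv K i) = a i := by simp [ev, Yv]
  have hZ (i : ℕ) : ev K a z (Zv K i) = z i := by simp [ev, Zv]
  have hlie (f g : FA K) : ev K a z ⁅f, g⁆ = ⁅ev K a z f, ev K a z g⁆ := by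
    simp [Ring.lie_def]
  have hcirc (f g : FA K) : ev K a z (circ f g) = circ (ev K a z f) (ev K a z g) := by
    simp [circ]
  have ha (i : ℕ) := A0star_le_span 0 (ha i)
  have hz (i : ℕ) := A0star_le_span 1 (hz i)
  rcases hf with rfl | rfl | rfl | rfl | rfl | rfl | rfl | rfl | rfl | rfl | rfl <;>
    simp only [map_add, map_sub, map_mul, hlie, hcirc, hY, hZ]
  · exact lie_lie_span (.inl rfl) (ha 1) (ha 2) (ha 3)
  · exact lie_lie_span (.inl rfl) (ha 1) (ha 2) (hz 3)
  · exact lie_lie_span (.inr rfl) (ha 1) (hz 2) (ha 3)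
  · exact circ_lie_span (ha 1) (hz 2) (hz 3)
  · exact lie_circ_span (hz 1) (hz 2) (hz 3)
  · exact circ_mul_circ_span (hz 1) (hz 2) (hz 3) (hz 4)
  · exact lie_mul_lie_span (ha 1) (ha 2) (ha 3) (ha 4)
  · exact lie_mul_lie_span (ha 1) (ha 2) (ha 3) (hz 4)
  · exact lie_mul_lie_span (hz 1) (ha 2) (ha 3) (ha 4)
  · exact lie_mul_lie_span (hz 1) (ha 2) (ha 3) (hz 4)
  · exact lie_mul_circ_span (ha 1) (hz 2) (hz 3) (hz 4)

end Identities

/-- the polynomials (1)–(7) are 2-graded identities of `E_{0*} ⊗ E_0`;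
consequently the `T₂`-ideal `I` they generate is contained in `T₂(E_{0*} ⊗ E_0)`. -/
theorem graded_identities_of_gens (K : Type) [Field K] [Infinite K] (h2 : (2 : K) ≠ 0) :
    (∀ f ∈ gens K, GIdent K (A0star K 0) (A0star K 1) f) ∧
    (∀ f ∈ T2IdealGen K (gens K), GIdent K (A0star K 0) (A0star K 1) f) := by
  refine ⟨fun f hf => gIdent_of_mem_gens hf, fun f hf => ?_⟩
  exact mem_identityIdeal.1 ((TwoSidedIdeal.mem_sInf _).1 hf _
    ⟨fun g hg => mem_identityIdeal.2 (gIdent_of_mem_gens hg), isT2Ideal_identityIdeal⟩)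

end Paper
end
end

section
/- The polynomial [z_1∘z_2, y_3] belongs to the T_2-ideal I. -/
open scoped TensorProduct

noncomputable section

namespace Paper

section

variable (K : Type) [Field K] in
/-- Renaming the even variables by `f` and the odd ones by `g`. -/
def rename (f g : ℕ → ℕ) : FA K →ₐ[K] FA K :=
  ev K (fun i => Yv K (f i)) (fun i => Zv K (g i))

variable {K : Type} [Field K]

@[simp]
theorem rename_Yv (f g : ℕ → ℕ) (i : ℕ) : rename K f g (Yv K i) = Yv K (f i) := by
  simp [rename, ev, Yv]

@[simp]
theorem rename_Zv (f g : ℕ → ℕ) (i : ℕ) : rename K f g (Zv K i) = Zv K (g i) := by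
  simp [rename, ev, Zv]

theorem Yv_mem_FAdeg (i : ℕ) : Yv K i ∈ FAdeg K 0 :=
  Submodule.subset_span ⟨[(false, i)], by simp, by simp [Yv]⟩

theorem Zv_mem_FAdeg (i : ℕ) : Zv K i ∈ FAdeg K 1 :=
  Submodule.subset_span ⟨[(true, i)], by simp, by simp [Zv]⟩

theorem gradedEndo_rename (f g : ℕ → ℕ) : GradedEndo K (rename K f g) :=
  ⟨fun i => by simpa using Yv_mem_FAdeg (f i), fun i => by simpa using Zv_mem_FAdeg (g i)⟩

theorem subset_T2IdealGen (S : Set (FA K)) : S ⊆ T2IdealGen K S := fun _ hx =>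
  (TwoSidedIdeal.mem_sInf _).2 fun _ hJ => hJ.1 hx

theorem isT2Ideal_T2IdealGen (S : Set (FA K)) : IsT2Ideal K (T2IdealGen K S) :=
  fun φ hφ x hx => (TwoSidedIdeal.mem_sInf _).2 fun _ hJ =>
    hJ.2 φ hφ x ((TwoSidedIdeal.mem_sInf _).1 hx _ hJ)

theorem circ_comm_Yv_Zv_mem (i j k : ℕ) :
    circ ⁅Yv K i, Zv K j⁆ (Zv K k) ∈ T2IdealGen K (gens K) := by
  have h : circ ⁅Yv K 1, Zv K 2⁆ (Zv K 3) ∈ T2IdealGen K (gens K) :=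
    subset_T2IdealGen _ (by simp [gens])
  have := isT2Ideal_T2IdealGen _ _
    (gradedEndo_rename (fun _ => i) (fun n => if n = 2 then j else k)) _ h
  simpa [circ, Ring.lie_def] using this

theorem circ_lie {R : Type*} [Ring R] (a b c : R) :
    ⁅circ a b, c⁆ = -(circ ⁅c, a⁆ b + circ ⁅c, b⁆ a) := by
  simp only [circ, Ring.lie_def]
  noncomm_ring

end

/-- the polynomial `[z_1 ∘ z_2, y_3]` lies in the `T₂`-ideal `I`. -/
theorem circ_comm_mem_I (K : Type) [Field K] [Infinite K] (h2 : (2 : K) ≠ 0) :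
    ⁅circ (Zv K 1) (Zv K 2), Yv K 3⁆ ∈ T2IdealGen K (gens K) := by
  rw [circ_lie]
  exact neg_mem (add_mem (circ_comm_Yv_Zv_mem 3 1 2) (circ_comm_Yv_Zv_mem 3 2 1))

end Paper
end
end
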